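/- Let N ≥ 1, α ∈ (0, 1/2), and δ > 0. Define the truncated kernel ρ_δ(z) := |z|^{−N−2α} if |z| ≥ δ and ρ_δ(z) := 0 if |z| < δ. For a Lebesgue-measurable set E ⊆ ℝ^N and x ∈ ℝ^N set κ_δ(x, E) := −2(1−α) ∫_{ℝ^N} (χ_E(y) − χ_{ℝ^N \ E}(y)) ρ_δ(x − y) dy, and for a measurable set W set J_δ(W) := (1−α) ∬_{ℝ^N×ℝ^N} |χ_W(x) − χ_W(y)| ρ_δ(x − y) dx dy. Then for every measurable function φ : ℝ^N → ℝ and every bounded Lebesgue-measurable set W ⊆ ℝ^N, one has ∫_W κ_δ(x, {y : φ(y) ≥ φ(x)}) dx ≤ J_δ(W). -/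

import Mathlib

open MeasureTheory Filter Set
open scoped ENNReal

/-- The truncated fractional kernel `ρ_δ(z) = |z|^{−N−2α}` for `|z| ≥ δ`, `0` otherwise. -/
noncomputable def rhoDelta (N : ℕ) (α δ : ℝ) (z : EuclideanSpace ℝ (Fin N)) : ℝ :=
  if δ ≤ ‖z‖ then ‖z‖ ^ (-((N : ℝ) + 2 * α)) else 0

/-- The truncated fractional curvature
`κ_δ(x, E) = −2(1−α) ∫ (χ_E(y) − χ_{Eᶜ}(y)) ρ_δ(x − y) dy`. -/
noncomputable def kappaDelta (N : ℕ) (α δ : ℝ) (x : EuclideanSpace ℝ (Fin N))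
    (E : Set (EuclideanSpace ℝ (Fin N))) : ℝ :=
  -2 * (1 - α) * ∫ y,
    (E.indicator (fun _ => (1:ℝ)) y - Eᶜ.indicator (fun _ => (1:ℝ)) y) *
      rhoDelta N α δ (x - y) ∂volume

/-- The truncated fractional perimeter
`J_δ(W) = (1−α) ∬ |χ_W(x) − χ_W(y)| ρ_δ(x − y) dx dy`. -/
noncomputable def Jdelta (N : ℕ) (α δ : ℝ) (W : Set (EuclideanSpace ℝ (Fin N))) : ℝ :=
  (1 - α) * ∫ x, (∫ y,
    |W.indicator (fun _ => (1:ℝ)) x - W.indicator (fun _ => (1:ℝ)) y| *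
      rhoDelta N α δ (x - y) ∂volume) ∂volume

theorem rhoDelta_nonneg (N : ℕ) (α δ : ℝ) (z : EuclideanSpace ℝ (Fin N)) :
    0 ≤ rhoDelta N α δ z := by
  unfold rhoDelta
  split_ifs <;> positivity

theorem rhoDelta_sub_comm (N : ℕ) (α δ : ℝ) (x y : EuclideanSpace ℝ (Fin N)) :
    rhoDelta N α δ (x - y) = rhoDelta N α δ (y - x) := by
  simp only [rhoDelta, norm_sub_rev x y]

theorem measurable_rhoDelta (N : ℕ) (α δ : ℝ) : Measurable (rhoDelta N α δ) :=
  Measurable.ite (measurableSet_le measurable_const measurable_norm)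
    (measurable_norm.pow_const _) measurable_const

theorem integrable_rhoDelta (N : ℕ) {α δ : ℝ} (hα : 0 < α) (hδ : 0 < δ) :
    Integrable (rhoDelta N α δ) := by
  have hp : ((Module.finrank ℝ (EuclideanSpace ℝ (Fin N)) : ℕ) : ℝ) < (N : ℝ) + 2 * α := by
    rw [finrank_euclideanSpace_fin]
    linarith
  refine ((integrable_one_add_norm (μ := volume) hp).const_mul
    ((1 + δ⁻¹) ^ ((N : ℝ) + 2 * α))).mono' (measurable_rhoDelta N α δ).aestronglyMeasurable
    (ae_of_all _ fun z => ?_)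
  rw [Real.norm_of_nonneg (rhoDelta_nonneg N α δ z), rhoDelta]
  split_ifs with h
  · have hz : 0 < ‖z‖ := hδ.trans_le h
    have hle : (1 + ‖z‖) / (1 + δ⁻¹) ≤ ‖z‖ := by
      rw [div_le_iff₀ (by positivity)]
      have h1 : 1 ≤ ‖z‖ * δ⁻¹ := by
        rw [← div_eq_mul_inv, one_le_div hδ]
        exact h
      linarith
    have hq : -((N : ℝ) + 2 * α) ≤ 0 := by
      have : (0 : ℝ) ≤ N := N.cast_nonneg
      linarith
    calc ‖z‖ ^ (-((N : ℝ) + 2 * α))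
        ≤ ((1 + ‖z‖) / (1 + δ⁻¹)) ^ (-((N : ℝ) + 2 * α)) :=
          Real.rpow_le_rpow_of_nonpos (by positivity) hle hq
      _ = (1 + δ⁻¹) ^ ((N : ℝ) + 2 * α) * (1 + ‖z‖) ^ (-((N : ℝ) + 2 * α)) := by
          rw [Real.div_rpow (by positivity) (by positivity),
            Real.rpow_neg (x := 1 + δ⁻¹) (by positivity), div_inv_eq_mul, mul_comm]
  · positivity

theorem integrable_indicator_mul_rhoDelta (N : ℕ) {α δ : ℝ} (hα : 0 < α) (hδ : 0 < δ)
    {W : Set (EuclideanSpace ℝ (Fin N))} (hW : MeasurableSet W) (hfin : volume W ≠ ∞) :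
    Integrable (fun p : EuclideanSpace ℝ (Fin N) × EuclideanSpace ℝ (Fin N) =>
      W.indicator (fun _ => (1 : ℝ)) p.1 * rhoDelta N α δ (p.1 - p.2))
      (volume.prod volume) := by
  have h := (((integrable_indicator_iff hW).2
    (integrableOn_const (C := (1 : ℝ)) hfin)).convolution_integrand (ContinuousLinearMap.mul ℝ ℝ)
    (integrable_rhoDelta N hα hδ)).swap
  refine h.congr (ae_of_all _ fun p => ?_)
  simp [rhoDelta_sub_comm N α δ p.1 p.2]

/-- For every measurable `φ` and every bounded measurable `W`,
`∫_W κ_δ(x, {φ ≥ φ(x)}) dx ≤ J_δ(W)`. -/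
theorem stmt12 (N : ℕ) (hN : 1 ≤ N)
    (α : ℝ) (hα : α ∈ Set.Ioo (0:ℝ) (1/2)) (δ : ℝ) (hδ : 0 < δ)
    (φ : EuclideanSpace ℝ (Fin N) → ℝ) (hφ : Measurable φ)
    (W : Set (EuclideanSpace ℝ (Fin N)))
    (hWmeas : MeasurableSet W) (hWbd : Bornology.IsBounded W) :
    ∫ x in W, kappaDelta N α δ x {y | φ x ≤ φ y} ∂volume ≤ Jdelta N α δ W := by
  obtain ⟨hα0, hα1⟩ := hα
  set ρ := rhoDelta N α δ
  set χ := W.indicator (fun _ => (1 : ℝ))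
  let s : EuclideanSpace ℝ (Fin N) × EuclideanSpace ℝ (Fin N) → ℝ := fun p =>
    {y | φ p.1 ≤ φ y}.indicator (fun _ => (1 : ℝ)) p.2 -
      {y | φ p.1 ≤ φ y}ᶜ.indicator (fun _ => (1 : ℝ)) p.2
  have hs_eq : ∀ p, s p = if φ p.1 ≤ φ p.2 then 1 else -1 := by
    intro p
    by_cases h : φ p.1 ≤ φ p.2 <;> simp [s, Set.indicator, h]
  have hs_meas : Measurable s := by
    rw [funext hs_eq]
    exact Measurable.ite (measurableSet_le (hφ.comp measurable_fst) (hφ.comp measurable_snd))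
      measurable_const measurable_const
  have hχρ := integrable_indicator_mul_rhoDelta N hα0 hδ hWmeas hWbd.measure_lt_top.ne
  have hf : Integrable (fun p : EuclideanSpace ℝ (Fin N) × EuclideanSpace ℝ (Fin N) =>
      s p * (χ p.1 * ρ (p.1 - p.2))) (volume.prod volume) := by
    refine hχρ.bdd_mul (c := 1) hs_meas.aestronglyMeasurable (ae_of_all _ fun p => ?_)
    rw [hs_eq]
    split_ifs <;> simp
  have hχ_meas : Measurable χ := measurable_const.indicator hWmeas
  have hρ0 : ∀ z, 0 ≤ ρ z := rhoDelta_nonneg N α δ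
  have hρ_symm : ∀ x y, ρ (x - y) = ρ (y - x) := rhoDelta_sub_comm N α δ
  have hg : Integrable (fun p : EuclideanSpace ℝ (Fin N) × EuclideanSpace ℝ (Fin N) =>
      |χ p.1 - χ p.2| * ρ (p.1 - p.2)) (volume.prod volume) := by
    refine (hχρ.add hχρ.swap).mono' ?_ (ae_of_all _ fun p => ?_)
    · exact (((hχ_meas.comp measurable_fst).sub (hχ_meas.comp measurable_snd)).abs.mul
        ((measurable_rhoDelta N α δ).comp
          (measurable_fst.sub measurable_snd))).aestronglyMeasurable
    · rw [Real.norm_of_nonneg (mul_nonneg (abs_nonneg _) (hρ0 _))]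
      change _ ≤ χ p.1 * ρ (p.1 - p.2) + χ p.2 * ρ (p.2 - p.1)
      rw [hρ_symm p.2 p.1, ← add_mul]
      refine mul_le_mul_of_nonneg_right ?_ (hρ0 _)
      by_cases h1 : p.1 ∈ W <;> by_cases h2 : p.2 ∈ W <;> simp [χ, h1, h2]
  have hswap : ∫ p, s p.swap * (χ p.2 * ρ (p.2 - p.1)) ∂(volume.prod volume) =
      ∫ p, s p * (χ p.1 * ρ (p.1 - p.2)) ∂(volume.prod volume) :=
    integral_prod_swap
      (fun p : EuclideanSpace ℝ (Fin N) × EuclideanSpace ℝ (Fin N) =>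
        s p * (χ p.1 * ρ (p.1 - p.2)))
  have hkey : -2 * ∫ p, s p * (χ p.1 * ρ (p.1 - p.2)) ∂(volume.prod volume) ≤
      ∫ p, |χ p.1 - χ p.2| * ρ (p.1 - p.2) ∂(volume.prod volume) := by
    have hmono := integral_mono (hf.add hf.swap).neg hg (fun p => by
      change -(s p * (χ p.1 * ρ (p.1 - p.2)) + s p.swap * (χ p.2 * ρ (p.2 - p.1))) ≤
        |χ p.1 - χ p.2| * ρ (p.1 - p.2)
      have hρ := hρ0 (p.1 - p.2)
      rw [hρ_symm p.2 p.1, hs_eq, hs_eq, Prod.fst_swap, Prod.snd_swap]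
      split_ifs <;> by_cases h1 : p.1 ∈ W <;> by_cases h2 : p.2 ∈ W <;>
        simp [χ, h1, h2] <;> linarith)
    have hsum : ∫ p, (-((fun p => s p * (χ p.1 * ρ (p.1 - p.2))) +
        (fun p => s p * (χ p.1 * ρ (p.1 - p.2))) ∘ Prod.swap)) p ∂(volume.prod volume) =
        -2 * ∫ p, s p * (χ p.1 * ρ (p.1 - p.2)) ∂(volume.prod volume) := by
      rw [integral_neg', integral_add' hf hf.swap]
      simp only [Function.comp_apply, Prod.fst_swap, Prod.snd_swap]
      rw [hswap]
      ring
    rwa [hsum] at hmono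
  have hleft : ∫ x in W, kappaDelta N α δ x {y | φ x ≤ φ y} =
      (1 - α) * (-2 * ∫ p, s p * (χ p.1 * ρ (p.1 - p.2)) ∂(volume.prod volume)) := by
    rw [← integral_indicator hWmeas, integral_prod _ hf, ← mul_assoc, ← integral_const_mul]
    congr 1 with x
    by_cases hx : x ∈ W
    · simp only [χ, Set.indicator_of_mem hx, one_mul, kappaDelta]
      rw [mul_comm (1 - α)]
    · simp [χ, hx]
  rw [hleft, Jdelta]
  refine mul_le_mul_of_nonneg_left ?_ (by linarith)
  rw [integral_prod _ hg] at hkey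
  exact hkey
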